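/- Let k = k(r) ≥ 2 and n = n(r) = k(r)·r be sequences indexed by r with λ = k − 1, and suppose k = o(n^{1−α}) for some fixed 0 < α < 1 as r → ∞. If m = m(r) is a sequence of positive integers with m = o(r), then the uniform probability that a {0,k}-mapping on [n] has exactly m cyclic nodes satisfies P_n^{{0,k}}(Z = m) = (λm/n)·exp(−λm²/(2n) + O(m³/r²) + o(1)) as r → ∞. Moreover, if m = m(r) is a sequence of reals with m → ∞ and m = o(r), then P_n^{{0,k}}(Z = ⌊m⌋) = (λm/n)·exp(−λm²/(2n) + O(m³/r²) + o(1)) as r → ∞. -/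

import Mathlib

open Filter Finset Asymptotics MeasureTheory

noncomputable section

open scoped Classical

/-- `f` is a `{0,k}`-mapping: every point has either `0` or `k` preimages. -/
def IsZKMap {n : ℕ} (k : ℕ) (f : Fin n → Fin n) : Prop :=
  ∀ y : Fin n,
    (Finset.univ.filter fun x => f x = y).card = 0 ∨
    (Finset.univ.filter fun x => f x = y).card = k

/-- The finite set of `{0,k}`-mappings on `[n]`. -/
def zkMaps (n k : ℕ) : Finset (Fin n → Fin n) :=
  Finset.univ.filter fun f => IsZKMap k f

/-- The set of cyclic nodes of `f`. -/
def cyclicSet {n : ℕ} (f : Fin n → Fin n) : Finset (Fin n) :=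
  Finset.univ.filter fun x => ∃ m, 0 < m ∧ f^[m] x = x

/-- `Z f`: the number of cyclic nodes of `f`. -/
def Zmap {n : ℕ} (f : Fin n → Fin n) : ℕ := (cyclicSet f).card

/-- The cycles of `f`: the orbits of the cyclic nodes under `f`. -/
def cyclesOf {n : ℕ} (f : Fin n → Fin n) : Finset (Finset (Fin n)) :=
  (cyclicSet f).image fun x => (cyclicSet f).filter fun y => ∃ m, f^[m] x = y

/-- `T f`: the least common multiple of the cycle lengths of `f`. -/
def Tmap {n : ℕ} (f : Fin n → Fin n) : ℕ := (cyclesOf f).lcm Finset.card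

/-- `B f`: the product of the cycle lengths of `f`, counted with multiplicity. -/
def Bmap {n : ℕ} (f : Fin n → Fin n) : ℕ := ∏ c ∈ cyclesOf f, c.card

/-- `C f`: the number of cycles of `f`. -/
def Cmap {n : ℕ} (f : Fin n → Fin n) : ℕ := (cyclesOf f).card

/-- Uniform probability of the event `p` over `{0,k}`-mappings on `[n]`. -/
def zkProb (n k : ℕ) (p : (Fin n → Fin n) → Prop) : ℝ :=
  (((zkMaps n k).filter p).card : ℝ) / ((zkMaps n k).card : ℝ)

/-- Expectation of `X` under the uniform measure on `{0,k}`-mappings on `[n]`. -/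
def zkExp (n k : ℕ) (X : (Fin n → Fin n) → ℝ) : ℝ :=
  (∑ f ∈ zkMaps n k, X f) / ((zkMaps n k).card : ℝ)

/-- The standard normal cumulative distribution function. -/
def stdNormalCDF (x : ℝ) : ℝ :=
  (Real.sqrt (2 * Real.pi))⁻¹ * ∫ t in Set.Iic x, Real.exp (-t ^ 2 / 2)

/-- `M m`: the average order of a uniformly random permutation of `[m]`. -/
def Mperm (m : ℕ) : ℝ :=
  (∑ σ : Equiv.Perm (Fin m), (orderOf σ : ℝ)) / (m.factorial : ℝ)

section Acyclic

open scoped Matrix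

variable {V R : Type*} [Fintype V] [DecidableEq V] [CommRing R]

/-- The adjacency matrix of the functional digraph of `f`, restricted to the complement of `S`. -/
def transientMatrix (R : Type*) [CommRing R] (S : Finset V) (f : V → V) : Matrix V V R :=
  Matrix.of fun u v => if u ∉ S ∧ v ∉ S ∧ f u = v then 1 else 0

/-- Every point is sent into `S` by some iterate of `f`. -/
def Reaches (S : Finset V) (f : V → V) : Prop := ∀ v, ∃ j, f^[j] v ∈ S

lemma transientMatrix_pow_apply_eq_zero (S : Finset V) (f : V → V) (j : ℕ) :
    ∀ u v, (∃ i ≤ j, f^[i] u ∈ S) → (transientMatrix R S f ^ (j + 1)) u v = 0 := by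
  induction j with
  | zero =>
    rintro u v ⟨i, hi, h⟩
    obtain rfl : i = 0 := by omega
    have h' : u ∈ S := h
    simp [transientMatrix, h']
  | succ j ih =>
    rintro u v ⟨i, hi, h⟩
    rw [pow_succ', Matrix.mul_apply]
    refine Finset.sum_eq_zero fun w _ => ?_
    by_cases hw : u ∉ S ∧ w ∉ S ∧ f u = w
    · obtain ⟨hu, -, rfl⟩ := hw
      rcases i with _ | i
      · exact absurd h hu
      · rw [ih (f u) v ⟨i, by omega, h⟩, mul_zero]
    · simp [transientMatrix, hw]

lemma det_one_sub_transientMatrix [IsDomain R] (S : Finset V) (f : V → V) :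
    (1 - transientMatrix R S f).det = if Reaches S f then 1 else 0 := by
  split_ifs with h
  · choose j hj using h
    have hnil : IsNilpotent (transientMatrix R S f) := by
      refine ⟨Finset.univ.sup j + 1, ?_⟩
      ext u v
      exact transientMatrix_pow_apply_eq_zero S f _ u v
        ⟨j u, Finset.le_sup (Finset.mem_univ u), hj u⟩
    have hc := (Matrix.isNilpotent_charpoly_sub_pow_of_isNilpotent hnil).eq_zero
    have := Matrix.eval_charpoly (transientMatrix R S f) 1
    rw [sub_eq_zero.mp hc] at this
    simpa using this.symm
  · rw [Reaches] at h
    push Not at h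
    obtain ⟨a, ha⟩ := h
    rw [← Matrix.exists_mulVec_eq_zero_iff]
    refine ⟨fun u => if ∀ j, f^[j] u ∉ S then 1 else 0, fun h0 => ?_, ?_⟩
    · simpa [ha] using congrFun h0 a
    · rw [Matrix.sub_mulVec, Matrix.one_mulVec, sub_eq_zero]
      funext u
      by_cases hu : u ∈ S
      · have : ¬ ∀ j, f^[j] u ∉ S := fun h => h 0 hu
        simp [transientMatrix, Matrix.mulVec, dotProduct, hu, this]
      · have key : (∀ j, f^[j] u ∉ S) ↔ f u ∉ S ∧ ∀ j, f^[j] (f u) ∉ S :=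
          ⟨fun h => ⟨h 1, fun j => h (j + 1)⟩, fun h j => by
            cases j with
            | zero => exact hu
            | succ j => exact h.2 j⟩
        have : ∀ w, (if u ∉ S ∧ w ∉ S ∧ f u = w then (1 : R) else 0) *
            (if ∀ j, f^[j] w ∉ S then 1 else 0) =
            if w = f u then (if f u ∉ S ∧ ∀ j, f^[j] (f u) ∉ S then 1 else 0) else 0 := by
          intro w
          by_cases hw : w = f u
          · subst hw
            by_cases h1 : f u ∈ S <;> simp [hu, h1]
          · simp [hw, Ne.symm hw]
        simp only [transientMatrix, Matrix.mulVec, dotProduct, Matrix.of_apply, this]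
        simp [key]

/-- The maps that agree with `σ` on `S`. -/
def agreeing (S : Finset V) (σ : V → V) : Finset (V → V) :=
  Fintype.piFinset fun u => if u ∈ S then {σ u} else Finset.univ

lemma mem_agreeing {S : Finset V} {σ f : V → V} :
    f ∈ agreeing S σ ↔ ∀ u ∈ S, f u = σ u := by
  simp only [agreeing, Fintype.mem_piFinset]
  refine forall_congr' fun u => ?_
  by_cases hu : u ∈ S <;> simp [hu]

/-- Weighted enumeration of the forests rooted at `S`. -/
lemma sum_reaches_weight [IsDomain R] [Nonempty V] (S : Finset V) (σ : V → V) (x : V → R) :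
    (∑ v, x v) ^ S.card * ∑ f ∈ agreeing S σ with Reaches S f, ∏ u, x (f u) =
      (∏ u ∈ S, x (σ u)) * ((∑ v, x v) ^ (Fintype.card V - 1) * ∑ v ∈ S, x v) := by
  set W := ∑ v, x v with hW
  let row : V → V → (V → R) := fun u w v =>
    if u ∈ S then W * (1 : Matrix V V R) u v
    else x w * ((1 : Matrix V V R) u v - if u ∉ S ∧ v ∉ S ∧ w = v then 1 else 0)
  have hrow : ∀ u, ∑ w ∈ (if u ∈ S then {σ u} else Finset.univ), row u w =
      (Matrix.scalar V W - Matrix.vecMulVec (fun u => if u ∈ S then 0 else 1)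
        (fun v => if v ∈ S then 0 else x v)) u := by
    intro u
    funext v
    by_cases hu : u ∈ S
    · simp [row, hu, Matrix.vecMulVec_apply, Matrix.one_apply, Matrix.diagonal_apply]
    · simp only [hu, if_false, Finset.sum_apply, row, mul_sub, Finset.sum_sub_distrib,
        ← Finset.sum_mul, ← hW]
      by_cases hv : v ∈ S <;>
      simp [hu, hv, Matrix.vecMulVec_apply, Matrix.one_apply, Matrix.diagonal_apply]
  have hdet := (Matrix.detRowAlternating (n := V) (R := R)).toMultilinearMap.map_sum_finset
    row (fun u => if u ∈ S then {σ u} else Finset.univ)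
  simp only [hrow] at hdet
  have hL : (Matrix.scalar V W - Matrix.vecMulVec (fun u => if u ∈ S then 0 else 1)
        (fun v => if v ∈ S then 0 else x v)).det =
      W ^ (Fintype.card V - 1) * ∑ v ∈ S, x v := by
    have hdot : (fun u => if u ∈ S then (0 : R) else 1) ⬝ᵥ (fun v => if v ∈ S then 0 else x v) =
        W - ∑ v ∈ S, x v := by
      rw [hW, ← Finset.sum_compl_add_sum S, add_sub_cancel_right, dotProduct,
        ← Finset.sum_add_sum_compl S, Finset.sum_eq_zero fun u hu => by simp [hu], zero_add]
      exact Finset.sum_congr rfl fun u hu => by simp [Finset.mem_compl.mp hu]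
    rw [← Matrix.eval_charpoly, Matrix.charpoly_vecMulVec, hdot]
    obtain ⟨c, hc⟩ := Nat.exists_eq_add_one_of_ne_zero (Fintype.card_ne_zero (α := V))
    simp only [hc, Polynomial.eval_sub, Polynomial.eval_pow, Polynomial.eval_X,
      Polynomial.eval_smul, smul_eq_mul, Nat.add_sub_cancel]
    ring
  have hR : ∀ f ∈ agreeing S σ, Matrix.det (fun u => row u (f u)) =
      W ^ S.card * (∏ u ∈ Sᶜ, x (f u)) * if Reaches S f then 1 else 0 := by
    intro f _
    rw [← det_one_sub_transientMatrix (R := R)]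
    have : (fun u => row u (f u)) = Matrix.of fun u v =>
        (if u ∈ S then W else x (f u)) * (1 - transientMatrix R S f) u v := by
      ext u v
      by_cases hu : u ∈ S <;> simp [row, hu, transientMatrix]
    rw [this, Matrix.det_mul_column, ← Finset.prod_mul_prod_compl S]
    congr 2
    · rw [Finset.prod_congr rfl (g := fun _ => W) (fun u hu => if_pos hu), Finset.prod_const]
    · exact Finset.prod_congr rfl fun u hu => if_neg (Finset.mem_compl.mp hu)
  have hdet' : W ^ (Fintype.card V - 1) * ∑ v ∈ S, x v =
      ∑ f ∈ agreeing S σ, Matrix.det (fun u => row u (f u)) := hL.symm.trans hdet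
  rw [hdet', Finset.sum_filter, Finset.mul_sum, Finset.mul_sum]
  refine Finset.sum_congr rfl fun f hf => ?_
  rw [hR f hf, ← Finset.prod_mul_prod_compl S,
    Finset.prod_congr rfl fun u hu => congrArg x (mem_agreeing.mp hf u hu)]
  split_ifs <;> ring

lemma sum_first_step_weight {S : Finset V} {u₀ : V} (hu₀ : u₀ ∉ S) (σ : V → V) (x : V → R) :
    (∑ v, x v) ^ S.card * ∑ f ∈ agreeing S σ with f u₀ ∈ S, ∏ u, x (f u) =
      (∏ u ∈ S, x (σ u)) * ((∑ v, x v) ^ (Fintype.card V - 1) * ∑ v ∈ S, x v) := by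
  have hset : {f ∈ agreeing S σ | f u₀ ∈ S} = Fintype.piFinset fun u =>
      if u ∈ S then {σ u} else if u = u₀ then S else Finset.univ := by
    ext f
    simp only [Finset.mem_filter, mem_agreeing, Fintype.mem_piFinset]
    constructor
    · rintro ⟨h1, h2⟩ u
      by_cases hu : u ∈ S
      · simp [hu, h1]
      · by_cases hu' : u = u₀
        · subst hu'; simpa [hu] using h2
        · simp [hu, hu']
    · intro h
      exact ⟨fun u hu => by simpa [hu] using h u, by simpa [hu₀] using h u₀⟩
  rw [hset, ← Finset.prod_univ_sum, ← Finset.prod_mul_prod_compl S,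
    ← Finset.mul_prod_erase Sᶜ _ (Finset.mem_compl.mpr hu₀)]
  have h1 : ∏ u ∈ S, ∑ w ∈ (if u ∈ S then {σ u} else if u = u₀ then S else Finset.univ), x w =
      ∏ u ∈ S, x (σ u) := Finset.prod_congr rfl fun u hu => by simp [hu]
  have h2 : ∏ u ∈ Sᶜ.erase u₀, ∑ w ∈ (if u ∈ S then {σ u} else if u = u₀ then S else
      Finset.univ), x w = (∑ v, x v) ^ (Sᶜ.erase u₀).card := by
    rw [← Finset.prod_const]
    refine Finset.prod_congr rfl fun u hu => ?_
    rw [Finset.mem_erase, Finset.mem_compl] at hu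
    simp [hu.1, hu.2]
  rw [h1, h2, Finset.card_erase_of_mem (Finset.mem_compl.mpr hu₀), Finset.card_compl]
  have hlt : S.card < Fintype.card V := Finset.card_lt_univ_of_notMem hu₀
  have : Fintype.card V - 1 = S.card + (Fintype.card V - S.card - 1) := by omega
  rw [this, pow_add]
  simp only [hu₀, if_false, if_true]
  ring

end Acyclic

section Content

variable {V : Type*} [Fintype V]

/-- The number of preimages of each point, as a monomial exponent. -/
def content (f : V → V) : V →₀ ℕ := ∑ u, Finsupp.single (f u) 1

lemma content_apply [DecidableEq V] (f : V → V) (y : V) :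
    content f y = (Finset.univ.filter fun x => f x = y).card := by
  rw [content, Finsupp.finsetSum_apply, Finset.card_filter]
  simp only [Finsupp.single_apply]

lemma prod_X_eq_monomial_content (f : V → V) :
    ∏ u, (MvPolynomial.X (f u) : MvPolynomial V ℤ) = MvPolynomial.monomial (content f) 1 := by
  simp only [MvPolynomial.X, content]
  rw [MvPolynomial.monomial_sum_one]

/-- Equal weight enumerators contain equally many maps whose content satisfies a property. -/
lemma card_filter_content_eq (A B : Finset (V → V)) (q : (V →₀ ℕ) → Prop)
    (h : ∑ f ∈ A, ∏ u, (MvPolynomial.X (f u) : MvPolynomial V ℤ) =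
      ∑ g ∈ B, ∏ u, MvPolynomial.X (g u)) :
    (A.filter fun f => q (content f)).card = (B.filter fun g => q (content g)).card := by
  let L := (MvPolynomial.basisMonomials V ℤ).constr ℤ (fun e => if q e then (1 : ℤ) else 0)
  have hL : ∀ f : V → V, L (∏ u, MvPolynomial.X (f u)) = if q (content f) then 1 else 0 := by
    intro f
    rw [prod_X_eq_monomial_content]
    simpa [L] using (MvPolynomial.basisMonomials V ℤ).constr_basis ℤ
      (fun e => if q e then (1 : ℤ) else 0) (content f)
  have := congrArg L h
  simp only [map_sum, hL, ← Finset.sum_filter] at this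
  simpa using this

end Content

section Counting

variable {n k r : ℕ}

lemma mem_zkMaps {f : Fin n → Fin n} : f ∈ zkMaps n k ↔ IsZKMap k f := by
  simp [zkMaps]

/-- Among the `{0,k}`-mappings agreeing with `σ` on `S`, those all of whose points reach `S` are as
many as those sending a given `u₀ ∉ S` into `S`. -/
lemma card_reaches_eq_card_first_step (S : Finset (Fin n)) {u₀ : Fin n} (hu₀ : u₀ ∉ S)
    (σ : Fin n → Fin n) :
    ((zkMaps n k).filter fun f => f ∈ agreeing S σ ∧ Reaches S f).card =
      ((zkMaps n k).filter fun f => f ∈ agreeing S σ ∧ f u₀ ∈ S).card := by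
  have : Nonempty (Fin n) := ⟨u₀⟩
  have hW : (∑ v, (MvPolynomial.X v : MvPolynomial (Fin n) ℤ)) ≠ 0 := fun h => by
    have := congrArg (MvPolynomial.eval (Pi.single u₀ (1 : ℤ))) h
    simp at this
  have h := mul_left_cancel₀ (pow_ne_zero S.card hW)
    ((sum_reaches_weight S σ (fun v => (MvPolynomial.X v : MvPolynomial (Fin n) ℤ))).trans
      (sum_first_step_weight hu₀ σ _).symm)
  have := card_filter_content_eq _ _ (fun e => ∀ y, e y = 0 ∨ e y = k) h
  simp only [content_apply] at this
  convert this using 2 <;>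
  · ext f
    rw [Finset.mem_filter, Finset.mem_filter, Finset.mem_filter, mem_zkMaps, IsZKMap, and_comm]

/-- A `{0,k}`-mapping whose range contains `S` sends exactly `k * |S|` points into `S`. -/
lemma card_preimage_of_subset_range {f : Fin n → Fin n} (hf : IsZKMap k f) {S : Finset (Fin n)}
    (hS : ∀ s ∈ S, ∃ u, f u = s) :
    (Finset.univ.filter fun u => f u ∈ S).card = k * S.card := by
  rw [Finset.card_eq_sum_card_fiberwise (f := f) (t := S) (fun u hu => by simpa using hu)]
  rw [Finset.sum_congr rfl (g := fun _ => k), Finset.sum_const, smul_eq_mul, mul_comm]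
  intro s hs
  obtain ⟨u, hu⟩ := hS s hs
  have h2 : {x ∈ Finset.univ.filter (fun u => f u ∈ S) | f x = s} =
      Finset.univ.filter fun x => f x = s := by
    ext x
    simp only [Finset.mem_filter, Finset.mem_univ, true_and]
    exact ⟨fun h => h.2, fun h => ⟨h ▸ hs, h⟩⟩
  rw [h2]
  refine (hf s).resolve_left fun h0 => ?_
  exact Finset.notMem_empty u (Finset.card_eq_zero.mp h0 ▸ by simp [hu])

/-- Among the points outside `S`, those sent into `S` number `(k - 1) * |S|`, when `f` permutes
`S`. -/
lemma card_outside_into {f : Fin n → Fin n} (hf : IsZKMap k f) {S : Finset (Fin n)}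
    (hmaps : ∀ u ∈ S, f u ∈ S) (hS : ∀ s ∈ S, ∃ u, f u = s) :
    ((Sᶜ.filter fun u => f u ∈ S).card : ℤ) = (k - 1) * S.card := by
  have h := card_preimage_of_subset_range hf hS
  have h2 : (Finset.univ.filter fun u => f u ∈ S) = S ∪ Sᶜ.filter fun u => f u ∈ S := by
    ext u
    by_cases hu : u ∈ S <;> simp [hu, hmaps]
  rw [h2, Finset.card_union_of_disjoint
    (Finset.disjoint_left.mpr fun u hu hu' => by simp [hu] at hu')] at h
  have h' : (S.card : ℤ) + (Sᶜ.filter fun u => f u ∈ S).card = k * S.card := by exact_mod_cast h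
  linarith

lemma sum_card_filter_comm {α β : Type*} (s : Finset α) (t : Finset β) (p : β → Prop)
    (q : α → β → Prop) [DecidablePred p] [∀ a b, Decidable (q a b)] :
    ∑ a ∈ s, ((t.filter fun b => p b ∧ q a b).card : ℤ) =
      ∑ b ∈ t.filter p, ((s.filter fun a => q a b).card : ℤ) := by
  simp only [Finset.card_filter, Nat.cast_sum, Finset.sum_filter]
  rw [Finset.sum_comm]
  refine Finset.sum_congr rfl fun b _ => ?_
  by_cases hb : p b <;> simp [hb]

/-- The permutations supported in `S`. -/
def permsOn (S : Finset (Fin n)) : Finset (Equiv.Perm (Fin n)) :=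
  Finset.univ.filter fun σ => ∀ v, v ∉ S → σ v = v

lemma mapsTo_of_mem_permsOn {S : Finset (Fin n)} {σ : Equiv.Perm (Fin n)} (hσ : σ ∈ permsOn S)
    {v : Fin n} (hv : v ∈ S) : σ v ∈ S := by
  by_contra h
  have h' := (Finset.mem_filter.mp hσ).2 _ h
  exact h (by rwa [σ.injective h'])

lemma card_permsOn (S : Finset (Fin n)) : (permsOn S).card = S.card.factorial := by
  have h := Fintype.card_congr (Equiv.Perm.subtypeEquivSubtypePerm (fun v : Fin n => v ∈ S))
  rw [Fintype.card_perm, Fintype.card_coe, Fintype.card_subtype] at h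
  rw [h, permsOn]

lemma card_reaches_mul (S : Finset (Fin n)) {σ : Equiv.Perm (Fin n)} (hσ : σ ∈ permsOn S) :
    ((n : ℤ) - S.card) *
        ((zkMaps n k).filter fun f => f ∈ agreeing S σ ∧ Reaches S f).card =
      (k - 1) * S.card * ((zkMaps n k).filter fun f => f ∈ agreeing S σ).card := by
  have h := sum_card_filter_comm Sᶜ (zkMaps n k) (fun f => f ∈ agreeing S σ) (fun u f => f u ∈ S)
  rw [Finset.sum_congr rfl fun u hu => by
    rw [← card_reaches_eq_card_first_step (k := k) S (Finset.mem_compl.mp hu) σ]] at h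
  rw [Finset.sum_const, Finset.card_compl, Fintype.card_fin, nsmul_eq_mul,
    Nat.cast_sub (by simpa using Finset.card_le_univ S)] at h
  rw [h, Finset.sum_congr rfl (g := fun _ => ((k : ℤ) - 1) * S.card), Finset.sum_const,
    nsmul_eq_mul, mul_comm]
  intro f hf
  obtain ⟨hf, hag⟩ := Finset.mem_filter.mp hf
  rw [mem_agreeing] at hag
  refine card_outside_into (mem_zkMaps.mp hf)
    (fun u hu => hag u hu ▸ mapsTo_of_mem_permsOn hσ hu) fun s hs => ?_
  have hs' : σ.symm s ∈ S := by
    by_contra hns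
    have := (Finset.mem_filter.mp hσ).2 _ hns
    rw [Equiv.apply_symm_apply] at this
    exact hns (this ▸ hs)
  exact ⟨σ.symm s, by rw [hag _ hs', Equiv.apply_symm_apply]⟩

lemma IsZKMap.comp_perm {f : Fin n → Fin n} (hf : IsZKMap k f) (τ : Equiv.Perm (Fin n)) :
    IsZKMap k (f ∘ τ) := by
  intro y
  rw [show (Finset.univ.filter fun x => (f ∘ τ) x = y).card =
      (Finset.univ.filter fun x => f x = y).card from
    Finset.card_equiv τ fun x => by simp]
  exact hf y

lemma IsZKMap.perm_comp {f : Fin n → Fin n} (hf : IsZKMap k f) (τ : Equiv.Perm (Fin n)) :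
    IsZKMap k (τ ∘ f) := by
  intro y
  simpa [← Equiv.eq_symm_apply] using hf (τ.symm y)

/-- Counting `{0,k}`-mappings is invariant under composition with permutations on both sides. -/
lemma card_zkMaps_filter_conj (τ ρ : Equiv.Perm (Fin n)) (p q : (Fin n → Fin n) → Prop)
    [DecidablePred p] [DecidablePred q] (h : ∀ f, p f ↔ q (τ ∘ f ∘ ρ)) :
    ((zkMaps n k).filter p).card = ((zkMaps n k).filter q).card := by
  refine Finset.card_bij' (fun f _ => τ ∘ f ∘ ρ) (fun g _ => τ.symm ∘ g ∘ ρ.symm) ?_ ?_ ?_ ?_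
  · intro f hf
    rw [Finset.mem_filter, mem_zkMaps] at hf ⊢
    exact ⟨(hf.1.comp_perm ρ).perm_comp τ, (h f).mp hf.2⟩
  · intro g hg
    rw [Finset.mem_filter, mem_zkMaps] at hg ⊢
    refine ⟨(hg.1.comp_perm ρ.symm).perm_comp τ.symm, (h _).mpr ?_⟩
    convert hg.2
    ext x
    simp
  · intro f _
    ext x
    simp
  · intro g _
    ext x
    simp

lemma card_agreeing_perm (S : Finset (Fin n)) (σ : Equiv.Perm (Fin n)) :
    ((zkMaps n k).filter fun f => f ∈ agreeing S σ).card =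
      ((zkMaps n k).filter fun f => f ∈ agreeing S id).card := by
  refine card_zkMaps_filter_conj σ.symm 1 _ _ fun f => ?_
  simp [mem_agreeing, Equiv.symm_apply_eq]

lemma card_fix_insert {S : Finset (Fin n)} {u₀ : Fin n} (hu₀ : u₀ ∉ S) :
    ((n : ℤ) - S.card) ^ 2 *
        ((zkMaps n k).filter fun f => f ∈ agreeing (insert u₀ S) id).card =
      (n - k * S.card) * ((zkMaps n k).filter fun f => f ∈ agreeing S id).card := by
  have hdiag : ∀ u, u ∉ S → ∀ v, v ∉ S →
      ((zkMaps n k).filter fun f => f ∈ agreeing S id ∧ f u = v).card =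
      ((zkMaps n k).filter fun f => f ∈ agreeing S id ∧ f v = v).card := by
    intro u hu v hv
    refine card_zkMaps_filter_conj 1 (Equiv.swap u v) _ _ fun f => ?_
    simp only [mem_agreeing, Equiv.Perm.coe_one, Function.id_comp, Function.comp_apply,
      Equiv.swap_apply_right]
    refine and_congr (forall₂_congr fun w hw => ?_) Iff.rfl
    rw [Equiv.swap_apply_of_ne_of_ne] <;> rintro rfl <;> contradiction
  have hdiag' : ∀ u, u ∉ S → ∀ v, v ∉ S →
      ((zkMaps n k).filter fun f => f ∈ agreeing S id ∧ f u = v).card =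
      ((zkMaps n k).filter fun f => f ∈ agreeing S id ∧ f u = u).card := by
    intro u hu v hv
    refine card_zkMaps_filter_conj (Equiv.swap u v) 1 _ _ fun f => ?_
    simp only [mem_agreeing, Equiv.Perm.coe_one, Function.comp_id, Function.comp_apply, id]
    refine and_congr (forall₂_congr fun w hw => ?_) ?_
    · rw [Equiv.swap_apply_eq_iff, Equiv.swap_apply_of_ne_of_ne] <;> rintro rfl <;> contradiction
    · rw [Equiv.swap_apply_eq_iff, Equiv.swap_apply_left]
  set F := ((zkMaps n k).filter fun f => f ∈ agreeing (insert u₀ S) id).card with hF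
  have hF' : ∀ u, u ∉ S → ∀ v, v ∉ S →
      ((zkMaps n k).filter fun f => f ∈ agreeing S id ∧ f u = v).card = F := by
    intro u hu v hv
    rw [hdiag u hu v hv, ← hdiag u₀ hu₀ v hv, hdiag' u₀ hu₀ v hv, hF]
    congr 1
    ext f
    simp only [Finset.mem_filter, mem_agreeing, Finset.mem_insert, forall_eq_or_imp, id]
    tauto
  have hcard : ((Sᶜ.card : ℕ) : ℤ) = n - S.card := by
    rw [Finset.card_compl, Fintype.card_fin, Nat.cast_sub (by simpa using Finset.card_le_univ S)]
  have h := sum_card_filter_comm (Sᶜ ×ˢ Sᶜ) (zkMaps n k) (fun f => f ∈ agreeing S id)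
    (fun a f => f a.1 = a.2)
  rw [Finset.sum_congr rfl (g := fun _ => (F : ℤ)) fun a ha => by
      rw [Finset.mem_product, Finset.mem_compl, Finset.mem_compl] at ha
      rw [hF' _ ha.1 _ ha.2],
    Finset.sum_const, Finset.card_product, nsmul_eq_mul, Nat.cast_mul, hcard] at h
  rw [sq, h, Finset.sum_congr rfl (g := fun _ => ((n : ℤ) - k * S.card)), Finset.sum_const,
    nsmul_eq_mul, mul_comm]
  intro f hf
  obtain ⟨hf, hag⟩ := Finset.mem_filter.mp hf
  rw [mem_agreeing] at hag
  have hin := card_outside_into (mem_zkMaps.mp hf) (fun u hu => by rwa [hag u hu])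
    (fun s hs => ⟨s, hag s hs⟩)
  have hsplit := Finset.card_filter_add_card_filter_not (s := Sᶜ) (fun u => f u ∈ S)
  have hgraph : ((Sᶜ ×ˢ Sᶜ).filter fun a => f a.1 = a.2).card =
      (Sᶜ.filter fun u => f u ∉ S).card := by
    refine Finset.card_bij' (fun a _ => a.1) (fun u _ => (u, f u)) ?_ ?_ ?_ ?_
    · rintro ⟨a, b⟩ h
      simp only [Finset.mem_filter, Finset.mem_product, Finset.mem_compl] at h ⊢
      exact ⟨h.1.1, h.2 ▸ h.1.2⟩
    · intro u h
      simpa using h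
    · rintro ⟨a, b⟩ h
      simp only [Finset.mem_filter] at h
      simp [h.2]
    · intro u _
      rfl
  have hsplit' : ((Sᶜ.filter fun u => f u ∈ S).card : ℤ) + (Sᶜ.filter fun u => f u ∉ S).card =
      n - S.card := by rw [← hcard]; exact_mod_cast hsplit
  rw [hgraph]
  linarith

lemma card_fix_mul_prod (S : Finset (Fin n)) :
    (((zkMaps n k).filter fun f => f ∈ agreeing S id).card : ℤ) *
        ∏ j ∈ Finset.range S.card, ((n : ℤ) - j) ^ 2 =
      (zkMaps n k).card * ∏ j ∈ Finset.range S.card, ((n : ℤ) - k * j) := by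
  induction S using Finset.induction_on with
  | empty => simp [mem_agreeing]
  | insert u S hu ih =>
    rw [Finset.card_insert_of_notMem hu, Finset.prod_range_succ, Finset.prod_range_succ]
    linear_combination (∏ j ∈ Finset.range S.card, ((n : ℤ) - j) ^ 2) * card_fix_insert (k := k) hu +
      ((n : ℤ) - k * S.card) * ih

lemma exists_permsOn_of_cyclicSet {f : Fin n → Fin n} :
    ∃ σ ∈ permsOn (cyclicSet f), f ∈ agreeing (cyclicSet f) σ := by
  have hmaps : ∀ u ∈ cyclicSet f, f u ∈ cyclicSet f := by
    intro u hu
    simp only [cyclicSet, Finset.mem_filter, Finset.mem_univ, true_and] at hu ⊢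
    obtain ⟨j, hj, h⟩ := hu
    exact ⟨j, hj, by rw [← Function.iterate_succ_apply, Function.iterate_succ_apply', h]⟩
  have hinj : ∀ u ∈ cyclicSet f, ∀ v ∈ cyclicSet f, f u = f v → u = v := by
    intro u hu v hv huv
    simp only [cyclicSet, Finset.mem_filter, Finset.mem_univ, true_and] at hu hv
    obtain ⟨i, hi, hu⟩ := hu
    obtain ⟨j, hj, hv⟩ := hv
    have hu' : f^[i * j] u = u := Function.IsPeriodicPt.mul_const (f := f) (m := i) hu j
    have hv' : f^[i * j] v = v := Function.IsPeriodicPt.const_mul (f := f) (m := j) hv i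
    obtain ⟨p, hp⟩ := Nat.exists_eq_add_one_of_ne_zero (Nat.mul_pos hi hj).ne'
    rw [← hu', ← hv', hp, Function.iterate_succ_apply, Function.iterate_succ_apply, huv]
  have hg : Function.Injective fun u => if u ∈ cyclicSet f then f u else u := by
    intro u v huv
    by_cases hu : u ∈ cyclicSet f <;> by_cases hv : v ∈ cyclicSet f <;>
      simp only [hu, hv, if_true, if_false] at huv
    · exact hinj u hu v hv huv
    · exact absurd (huv ▸ hmaps u hu) hv
    · exact absurd (huv ▸ hmaps v hv) hu
    · exact huv
  refine ⟨Equiv.ofBijective _ (Finite.injective_iff_bijective.mp hg), ?_, ?_⟩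
  · simp +contextual [permsOn]
  · simp +contextual [mem_agreeing]

lemma reaches_cyclicSet (f : Fin n → Fin n) : Reaches (cyclicSet f) f := by
  intro v
  obtain ⟨i, j, hij, h⟩ := Finite.exists_ne_map_eq_of_infinite fun i : ℕ => f^[i] v
  wlog hlt : i < j generalizing i j
  · exact this j i hij.symm h.symm (by omega)
  refine ⟨i, ?_⟩
  simp only [cyclicSet, Finset.mem_filter, Finset.mem_univ, true_and]
  refine ⟨j - i, by omega, ?_⟩
  rw [← Function.iterate_add_apply, Nat.sub_add_cancel hlt.le]
  exact h.symm

lemma cyclicSet_eq_of_agreeing {S : Finset (Fin n)} {σ : Equiv.Perm (Fin n)}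
    (hσ : σ ∈ permsOn S) {f : Fin n → Fin n} (hf : f ∈ agreeing S σ) (hr : Reaches S f) :
    cyclicSet f = S := by
  rw [mem_agreeing] at hf
  have hit : ∀ u ∈ S, ∀ j, f^[j] u = (σ ^ j) u ∧ f^[j] u ∈ S := by
    intro u hu j
    induction j with
    | zero => simpa using hu
    | succ j ih =>
      rw [Function.iterate_succ_apply', hf _ ih.2]
      exact ⟨by rw [ih.1, pow_succ', Equiv.Perm.mul_apply], mapsTo_of_mem_permsOn hσ ih.2⟩
  ext u
  simp only [cyclicSet, Finset.mem_filter, Finset.mem_univ, true_and]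
  constructor
  · rintro ⟨p, hp, h⟩
    obtain ⟨j, hj⟩ := hr u
    have h1 : f^[p * j] u = u := Function.IsPeriodicPt.mul_const (f := f) (m := p) h j
    have h2 : p * j = (p * j - j) + j := by
      have := Nat.le_mul_of_pos_left j hp
      omega
    rw [h2, Function.iterate_add_apply] at h1
    exact h1 ▸ (hit _ hj _).2
  · intro hu
    exact ⟨orderOf σ, orderOf_pos σ, by rw [(hit u hu _).1, pow_orderOf_eq_one]; rfl⟩

lemma card_cyclicSet_eq (S : Finset (Fin n)) :
    ((zkMaps n k).filter fun f => cyclicSet f = S).card =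
      ∑ σ ∈ permsOn S, ((zkMaps n k).filter fun f => f ∈ agreeing S σ ∧ Reaches S f).card := by
  rw [← Finset.card_biUnion]
  · congr 1
    ext f
    simp only [Finset.mem_filter, Finset.mem_biUnion]
    constructor
    · rintro ⟨hf, rfl⟩
      obtain ⟨σ, hσ, h⟩ := exists_permsOn_of_cyclicSet (f := f)
      exact ⟨σ, hσ, hf, h, reaches_cyclicSet f⟩
    · rintro ⟨σ, hσ, hf, h, hr⟩
      exact ⟨hf, cyclicSet_eq_of_agreeing hσ h hr⟩
  · intro σ hσ τ hτ hne
    refine Finset.disjoint_left.mpr fun f hf hf' => hne ?_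
    simp only [Finset.mem_filter, mem_agreeing] at hf hf'
    ext1 u
    by_cases hu : u ∈ S
    · rw [← hf.2.1 u hu, hf'.2.1 u hu]
    · rw [(Finset.mem_filter.mp hσ).2 u hu, (Finset.mem_filter.mp hτ).2 u hu]

lemma card_Zmap_eq_mul (m : ℕ) :
    ((n : ℤ) - m) * (∏ j ∈ Finset.range m, ((n : ℤ) - j) ^ 2) *
        ((zkMaps n k).filter fun f => Zmap f = m).card =
      n.choose m * m.factorial * ((k - 1) * m) *
        ((zkMaps n k).card * ∏ j ∈ Finset.range m, ((n : ℤ) - k * j)) := by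
  have h1 : ((zkMaps n k).filter fun f => Zmap f = m).card =
      ∑ S ∈ Finset.powersetCard m Finset.univ,
        ((zkMaps n k).filter fun f => cyclicSet f = S).card := by
    rw [Finset.card_eq_sum_card_fiberwise (f := cyclicSet)
      (t := Finset.powersetCard m Finset.univ) (fun f hf => by
        simpa [Zmap] using (Finset.mem_filter.mp hf).2)]
    refine Finset.sum_congr rfl fun S hS => ?_
    rw [Finset.mem_powersetCard] at hS
    congr 1
    ext f
    rw [Finset.mem_filter, Finset.mem_filter, Finset.mem_filter, Zmap]
    exact ⟨fun h => ⟨h.1.1, h.2⟩, fun h => ⟨⟨h.1, h.2 ▸ hS.2⟩, h.2⟩⟩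
  have h2 : ∀ S ∈ Finset.powersetCard m (Finset.univ : Finset (Fin n)),
      ((n : ℤ) - m) * (∏ j ∈ Finset.range m, ((n : ℤ) - j) ^ 2) *
        ((zkMaps n k).filter fun f => cyclicSet f = S).card =
      m.factorial * (((k - 1) * m) *
        ((zkMaps n k).card * ∏ j ∈ Finset.range m, ((n : ℤ) - k * j))) := by
    intro S hS
    obtain ⟨-, rfl⟩ := Finset.mem_powersetCard.mp hS
    rw [card_cyclicSet_eq, ← card_permsOn S, Nat.cast_sum, Finset.mul_sum, ← nsmul_eq_mul,
      ← Finset.sum_const]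
    refine Finset.sum_congr rfl fun σ hσ => ?_
    have h3 := card_reaches_mul (k := k) S hσ
    rw [card_agreeing_perm] at h3
    linear_combination (∏ j ∈ Finset.range S.card, ((n : ℤ) - j) ^ 2) * h3 +
      (((k : ℤ) - 1) * S.card) * card_fix_mul_prod (k := k) S
  rw [h1, Nat.cast_sum, Finset.mul_sum, Finset.sum_congr rfl h2, Finset.sum_const,
    Finset.card_powersetCard, Finset.card_univ, Fintype.card_fin, nsmul_eq_mul]
  ring

lemma zkMaps_card_pos (k r : ℕ) : 0 < (zkMaps (k * r) k).card := by
  rcases Nat.eq_zero_or_pos k with rfl | hk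
  · rw [Finset.card_pos]
    exact ⟨id, mem_zkMaps.mpr fun y => absurd y.2 (by simp)⟩
  have hle : r ≤ k * r := Nat.le_mul_of_pos_left r hk
  let e : Fin (k * r) ≃ Fin k × Fin r := finProdFinEquiv.symm
  refine Finset.card_pos.mpr ⟨fun x => Fin.castLE hle (e x).2, mem_zkMaps.mpr fun y => ?_⟩
  by_cases hy : (y : ℕ) < r
  · right
    rw [Finset.card_equiv (t := Finset.univ ×ˢ {(⟨y, hy⟩ : Fin r)}) e]
    · simp
    · intro x
      simp [Finset.mem_product, Finset.mem_singleton, Fin.ext_iff, -Finset.product_singleton]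
  · left
    rw [Finset.card_eq_zero, Finset.filter_eq_empty_iff]
    intro x _ h
    exact hy (h ▸ (e x).2.2)

/-- The exact distribution of the number of cyclic nodes (Rubin and Sitgreaves). -/
lemma zkProb_Zmap_eq {m : ℕ} (hm : m < n) (hn : n = k * r) :
    zkProb n k (fun f => Zmap f = m) =
      ((k : ℝ) - 1) * m / (n - m) * ∏ j ∈ Finset.range m, (((n : ℝ) - k * j) / (n - j)) := by
  have h := congrArg (Int.cast : ℤ → ℝ) (card_Zmap_eq_mul (n := n) (k := k) m)
  push_cast at h
  have hdesc : (n.choose m : ℝ) * m.factorial = ∏ j ∈ Finset.range m, ((n : ℝ) - j) := by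
    rw [mul_comm, ← Nat.cast_mul, ← Nat.descFactorial_eq_factorial_mul_choose,
      Nat.descFactorial_eq_prod_range, Nat.cast_prod]
    refine Finset.prod_congr rfl fun j hj => ?_
    rw [Nat.cast_sub (by have := Finset.mem_range.mp hj; omega)]
  have hpos : (0 : ℝ) < (zkMaps n k).card := by
    subst hn
    exact_mod_cast zkMaps_card_pos k r
  have hm' : (0 : ℝ) < n - m := sub_pos.mpr (by exact_mod_cast hm)
  have hP : 0 < ∏ j ∈ Finset.range m, ((n : ℝ) - j) := Finset.prod_pos fun j hj =>
    sub_pos.mpr (by have := Finset.mem_range.mp hj; exact_mod_cast this.trans hm)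
  rw [hdesc, Finset.prod_pow] at h
  have hdef : zkProb n k (fun f => Zmap f = m) =
      ((zkMaps n k).filter fun f => Zmap f = m).card / (zkMaps n k).card := by
    rw [zkProb]
    congr!
  rw [hdef, Finset.prod_div_distrib, div_mul_div_comm, div_eq_div_iff hpos.ne' (by positivity)]
  apply mul_right_cancel₀ hP.ne'
  linear_combination h

end Counting

section Asymptotics

lemma log_one_sub_bounds {t : ℝ} (h1 : t ≤ 1 / 2) :
    -(2 * t ^ 2) ≤ Real.log (1 - t) + t ∧ Real.log (1 - t) + t ≤ 0 := by
  have hpos : 0 < 1 - t := by linarith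
  constructor
  · have h := Real.one_sub_inv_le_log_of_pos hpos
    have h2 : (1 - t)⁻¹ ≤ 1 + t + 2 * t ^ 2 := by
      rw [inv_le_iff_one_le_mul₀ hpos]
      nlinarith [mul_nonneg (sq_nonneg t) (by linarith : 0 ≤ 1 - 2 * t)]
    linarith
  · linarith [Real.log_le_sub_one_of_pos hpos]

/-- The logarithmic error of the Gaussian-type approximation to the law of `Z`. -/
def zkLogError (n k m : ℕ) : ℝ :=
  -Real.log (1 - (m : ℝ) / n) +
    ∑ j ∈ Finset.range m, (Real.log (1 - (k * j : ℝ) / n) - Real.log (1 - (j : ℝ) / n)) +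
    ((k : ℝ) - 1) * m ^ 2 / (2 * n)

lemma zkProb_eq_exp_zkLogError {n k r m : ℕ} (hk : 2 ≤ k) (hn : n = k * r) (hm : 1 ≤ m)
    (hmr : m < r) :
    zkProb n k (fun f => Zmap f = m) =
      ((k : ℝ) - 1) * m / n *
        Real.exp (-(((k : ℝ) - 1) * m ^ 2 / (2 * n)) + zkLogError n k m) := by
  have hrn : r ≤ n := hn ▸ Nat.le_mul_of_pos_left r (by omega)
  have hn0 : (0 : ℝ) < n := by exact_mod_cast (show 0 < n by omega)
  have hmn : (m : ℝ) < n := by exact_mod_cast hmr.trans_le hrn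
  have hfac : ∀ j ∈ Finset.range m, 0 < 1 - (k * j : ℝ) / n ∧ 0 < 1 - (j : ℝ) / n := by
    intro j hj
    have hj := Finset.mem_range.mp hj
    constructor
    · rw [sub_pos, div_lt_one hn0, hn]
      exact_mod_cast (Nat.mul_lt_mul_left (by omega)).mpr (hj.trans hmr)
    · rw [sub_pos, div_lt_one hn0]
      exact (Nat.cast_lt.mpr hj).trans hmn
  have hexp : Real.exp (-(((k : ℝ) - 1) * m ^ 2 / (2 * n)) + zkLogError n k m) =
      (1 - (m : ℝ) / n)⁻¹ * ∏ j ∈ Finset.range m, ((1 - (k * j : ℝ) / n) / (1 - (j : ℝ) / n)) := by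
    rw [zkLogError, neg_add_eq_sub, add_sub_cancel_right, Real.exp_add, Real.exp_neg,
      Real.exp_log (by rw [sub_pos, div_lt_one hn0]; exact hmn), Real.exp_sum]
    congr 1
    refine Finset.prod_congr rfl fun j hj => ?_
    rw [Real.exp_sub, Real.exp_log (hfac j hj).1, Real.exp_log (hfac j hj).2]
  rw [zkProb_Zmap_eq (hmr.trans_le hrn) hn, hexp, ← mul_assoc]
  congr 1
  · have : (n : ℝ) - m ≠ 0 := by linarith
    field_simp
  · refine Finset.prod_congr rfl fun j _ => ?_
    rw [one_sub_div hn0.ne', one_sub_div hn0.ne', div_div_div_cancel_right₀ hn0.ne']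

lemma abs_zkLogError_le {n k r m : ℕ} (hk : 2 ≤ k) (hn : n = k * r) (hm : 1 ≤ m)
    (hmr : 2 * m ≤ r) :
    |zkLogError n k m| ≤ 2 * ((m : ℝ) ^ 3 / r ^ 2 + m / r) := by
  have hr0 : (0 : ℝ) < r := by exact_mod_cast (show 0 < r by omega)
  have hk0 : (2 : ℝ) ≤ k := by exact_mod_cast hk
  have hnr : (n : ℝ) = k * r := by rw [hn]; push_cast; ring
  have hmr' : 2 * (m : ℝ) ≤ r := by exact_mod_cast hmr
  have hm0 : (0 : ℝ) < m := by exact_mod_cast hm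
  have hn2 : 2 * (r : ℝ) ≤ n := by rw [hnr]; gcongr
  have hn0 : (0 : ℝ) < n := by linarith
  have hsmall : ∀ j : ℝ, 0 ≤ j → j ≤ m → j / n ≤ j / r ∧ 0 ≤ j / n ∧ j / r ≤ 1 / 2 := by
    intro j hj hjm
    refine ⟨div_le_div_of_nonneg_left hj hr0 (by linarith), by positivity, ?_⟩
    rw [div_le_iff₀ hr0]
    linarith
  have hterm : ∀ j ∈ Finset.range m,
      |Real.log (1 - (k * j : ℝ) / n) - Real.log (1 - (j : ℝ) / n) - (-((k : ℝ) - 1) / n * j)| ≤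
        2 * ((m : ℝ) / r) ^ 2 := by
    intro j hj
    have hjm : (j : ℝ) ≤ m := by exact_mod_cast (Finset.mem_range.mp hj).le
    obtain ⟨h1, h2, h3⟩ := hsmall j (Nat.cast_nonneg j) hjm
    have hkj : (k * j : ℝ) / n = j / r := by rw [hnr, mul_div_mul_left _ _ (by linarith)]
    have hlin : -((k : ℝ) - 1) / n * j = j / n - (k * j : ℝ) / n := by ring
    have hjr : (j : ℝ) / r ≤ m / r := by gcongr
    obtain ⟨a1, a2⟩ := log_one_sub_bounds h3
    obtain ⟨b1, b2⟩ := log_one_sub_bounds (h1.trans h3)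
    have c1 : ((j : ℝ) / r) ^ 2 ≤ (m / r) ^ 2 := by gcongr
    have c2 : ((j : ℝ) / n) ^ 2 ≤ (m / r) ^ 2 := 
      pow_le_pow_left₀ h2 (h1.trans hjr) 2
    rw [hlin, hkj, abs_le]
    constructor <;> linarith
  have hsum : ∑ j ∈ Finset.range m, (-((k : ℝ) - 1) / n * j) =
      -(((k : ℝ) - 1) * m ^ 2 / (2 * n)) + ((k : ℝ) - 1) * m / (2 * n) := by
    have hg : (∑ j ∈ Finset.range m, (j : ℝ)) = m * (m - 1) / 2 := by
      have := Finset.sum_range_id_mul_two m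
      have h2 : ((∑ j ∈ Finset.range m, j : ℕ) : ℝ) * 2 = m * (m - 1) := by
        have h3 : (((m - 1 : ℕ) : ℝ)) = m - 1 := by simp [Nat.cast_sub hm]
        rw [← h3]
        exact_mod_cast this
      rw [← Nat.cast_sum]
      linarith
    rw [← Finset.mul_sum, hg]
    field_simp
    ring
  have htot : |∑ j ∈ Finset.range m, (Real.log (1 - (k * j : ℝ) / n) -
      Real.log (1 - (j : ℝ) / n) - (-((k : ℝ) - 1) / n * j))| ≤ 2 * ((m : ℝ) ^ 3 / r ^ 2) := by
    refine (Finset.abs_sum_le_sum_abs _ _).trans ((Finset.sum_le_sum hterm).trans_eq ?_)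
    rw [Finset.sum_const, Finset.card_range, nsmul_eq_mul]
    ring
  rw [Finset.sum_sub_distrib, hsum] at htot
  obtain ⟨h1, h2, h3⟩ := hsmall m hm0.le le_rfl
  obtain ⟨b1, b2⟩ := log_one_sub_bounds (h1.trans h3)
  have hmn : (m : ℝ) / n ≤ m / r / 2 := by
    rw [div_div]
    gcongr
    linarith
  have hsq : 2 * ((m : ℝ) / n) ^ 2 ≤ m / n := by nlinarith
  have hlam : ((k : ℝ) - 1) * m / (2 * n) ≤ m / r / 2 := by
    rw [hnr, div_div, div_le_div_iff₀ (by positivity) (by positivity)]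
    nlinarith [mul_pos hm0 hr0]
  have hlam0 : 0 ≤ ((k : ℝ) - 1) * m / (2 * n) :=
    div_nonneg (mul_nonneg (by linarith) hm0.le) (by linarith)
  have hmr0 : 0 ≤ (m : ℝ) / r := by positivity
  rw [abs_le] at htot ⊢
  rw [zkLogError]
  constructor <;> linarith [htot.1, htot.2]

/-- A sequence dominated by the sum of `a` and a null sequence splits accordingly. -/
lemma exists_split_of_abs_le {D a b : ℕ → ℝ} {C : ℝ} (ha : ∀ᶠ r in atTop, 0 ≤ a r)
    (hb : ∀ᶠ r in atTop, 0 ≤ b r) (hb0 : Tendsto b atTop (nhds 0))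
    (hD : ∀ᶠ r in atTop, |D r| ≤ C * (a r + b r)) :
    ∃ E₁ E₂ : ℕ → ℝ, (∀ᶠ r in atTop, D r = E₁ r + E₂ r) ∧ E₁ =O[atTop] a ∧
      Tendsto E₂ atTop (nhds 0) := by
  have key : ∀ x y z : ℝ, 0 ≤ y → 0 ≤ z → |x| ≤ C * (y + z) → |x * (y / (y + z))| ≤ C * y := by
    intro x y z hy hz h
    rcases (add_nonneg hy hz).eq_or_lt with h0 | h0
    · have : y = 0 := by linarith
      simp [this]
    · rw [abs_mul, abs_of_nonneg (div_nonneg hy h0.le), mul_div_assoc', div_le_iff₀ h0]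
      nlinarith
  refine ⟨fun r => D r * (a r / (a r + b r)), fun r => D r * (b r / (b r + a r)), ?_, ?_, ?_⟩
  · filter_upwards [ha, hb, hD] with r h1 h2 h3
    rcases (add_nonneg h1 h2).eq_or_lt with h0 | h0
    · rw [← h0, mul_zero] at h3
      simp [abs_nonpos_iff.mp h3]
    · rw [add_comm (b r)]
      field_simp
  · refine IsBigO.of_bound C ?_
    filter_upwards [ha, hb, hD] with r h1 h2 h3
    rw [Real.norm_eq_abs, Real.norm_eq_abs, abs_of_nonneg h1]
    exact key _ _ _ h1 h2 h3
  · refine squeeze_zero_norm' (a := fun r => C * b r) ?_ (by simpa using hb0.const_mul C)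
    filter_upwards [ha, hb, hD] with r h1 h2 h3
    exact key _ _ _ h2 h1 (by rwa [add_comm (b r)])

end Asymptotics

/-- asymptotic distribution of the number of cyclic nodes of a
uniform `{0,k}`-mapping, for `m = o(r)`. -/
theorem stmt_2 (k n : ℕ → ℕ) (α : ℝ) (hα1 : 0 < α) (hα2 : α < 1)
    (hk : ∀ r, 2 ≤ k r) (hn : ∀ r, n r = k r * r)
    (hko : (fun r : ℕ => (k r : ℝ)) =o[atTop] (fun r : ℕ => (n r : ℝ) ^ (1 - α))) :
    (∀ m : ℕ → ℕ, (∀ r, 1 ≤ m r) →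
      (fun r : ℕ => (m r : ℝ)) =o[atTop] (fun r : ℕ => (r : ℝ)) →
      ∃ E₁ E₂ : ℕ → ℝ,
        (∀ᶠ r in atTop,
          zkProb (n r) (k r) (fun f => Zmap f = m r) =
            ((k r : ℝ) - 1) * (m r : ℝ) / (n r : ℝ) *
              Real.exp (-(((k r : ℝ) - 1) * (m r : ℝ) ^ 2 / (2 * (n r : ℝ))) +
                E₁ r + E₂ r)) ∧
        E₁ =O[atTop] (fun r => (m r : ℝ) ^ 3 / (r : ℝ) ^ 2) ∧
        Tendsto E₂ atTop (nhds 0)) ∧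
    (∀ m : ℕ → ℝ, Tendsto m atTop atTop →
      m =o[atTop] (fun r : ℕ => (r : ℝ)) →
      ∃ E₁ E₂ : ℕ → ℝ,
        (∀ᶠ r in atTop,
          zkProb (n r) (k r) (fun f => Zmap f = ⌊m r⌋₊) =
            ((k r : ℝ) - 1) * m r / (n r : ℝ) *
              Real.exp (-(((k r : ℝ) - 1) * (m r) ^ 2 / (2 * (n r : ℝ))) +
                E₁ r + E₂ r)) ∧
        E₁ =O[atTop] (fun r => (m r) ^ 3 / (r : ℝ) ^ 2) ∧
        Tendsto E₂ atTop (nhds 0)) := by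
  constructor
  · intro m hm hmo
    have hm2 : ∀ᶠ r in atTop, 2 * m r ≤ r := by
      filter_upwards [hmo.bound (show (0 : ℝ) < 1 / 2 by norm_num)] with r hr
      simp only [Real.norm_natCast] at hr
      have : 2 * (m r : ℝ) ≤ r := by linarith
      exact_mod_cast this
    obtain ⟨E₁, E₂, hE, hE₁, hE₂⟩ := exists_split_of_abs_le
      (D := fun r => zkLogError (n r) (k r) (m r)) (a := fun r => (m r : ℝ) ^ 3 / (r : ℝ) ^ 2)
      (b := fun r => (m r : ℝ) / r) (C := 2) (.of_forall fun r => by positivity)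
      (.of_forall fun r => by positivity) hmo.tendsto_div_nhds_zero (by
        filter_upwards [hm2] with r hr
        exact abs_zkLogError_le (hk r) (hn r) (hm r) hr)
    refine ⟨E₁, E₂, ?_, hE₁, hE₂⟩
    filter_upwards [hE, hm2] with r h1 h2
    have := hm r
    rw [add_assoc, ← h1]
    exact zkProb_eq_exp_zkLogError (hk r) (hn r) (hm r) (by omega)
  · intro m hm hmo
    have hm1 : ∀ᶠ r in atTop, 1 ≤ m r := hm.eventually_ge_atTop 1
    have hm2 : ∀ᶠ r : ℕ in atTop, 2 * m r ≤ r := by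
      filter_upwards [hmo.bound (show (0 : ℝ) < 1 / 2 by norm_num)] with r hr
      rw [Real.norm_natCast] at hr
      linarith [(le_abs_self (m r)).trans hr]
    have hlog : Tendsto (fun r => |Real.log (⌊m r⌋₊ / m r)|) atTop (nhds 0) := by
      have := ((Real.continuousAt_log one_ne_zero).tendsto.comp
        ((tendsto_nat_floor_div_atTop (R := ℝ)).comp hm)).abs
      simpa using this
    obtain ⟨E₁, E₂, hE, hE₁, hE₂⟩ := exists_split_of_abs_le
      (D := fun r => zkLogError (n r) (k r) ⌊m r⌋₊ + (Real.log (⌊m r⌋₊ / m r) +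
        ((k r : ℝ) - 1) * (m r ^ 2 - (⌊m r⌋₊ : ℝ) ^ 2) / (2 * n r)))
      (a := fun r => m r ^ 3 / (r : ℝ) ^ 2)
      (b := fun r => m r / r + |Real.log (⌊m r⌋₊ / m r)|) (C := 3)
      (by filter_upwards [hm1] with r hr; positivity)
      (by filter_upwards [hm1] with r hr; positivity)
      (by simpa using hmo.tendsto_div_nhds_zero.add hlog) (by
        filter_upwards [hm1, hm2] with r h1 h2
        have hfl : (⌊m r⌋₊ : ℝ) ≤ m r := Nat.floor_le (by linarith)
        have hfl' : m r < ⌊m r⌋₊ + 1 := Nat.lt_floor_add_one _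
        have hf1 : 1 ≤ ⌊m r⌋₊ := Nat.one_le_floor_iff (m r) |>.mpr h1
        have hr0 : (0 : ℝ) < r := by linarith
        have hk2 : (2 : ℝ) ≤ k r := by exact_mod_cast hk r
        have hnr : (n r : ℝ) = k r * r := by rw [hn r]; push_cast; ring
        have hd0 : 0 ≤ m r ^ 2 - (⌊m r⌋₊ : ℝ) ^ 2 := by
          have : (⌊m r⌋₊ : ℝ) ^ 2 ≤ m r ^ 2 := by gcongr
          linarith
        have hd1 : m r ^ 2 - (⌊m r⌋₊ : ℝ) ^ 2 ≤ 2 * m r := by nlinarith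
        have hq0 : 0 ≤ ((k r : ℝ) - 1) * (m r ^ 2 - (⌊m r⌋₊ : ℝ) ^ 2) / (2 * n r) :=
          div_nonneg (mul_nonneg (by linarith) hd0) (by positivity)
        have hq1 : ((k r : ℝ) - 1) * (m r ^ 2 - (⌊m r⌋₊ : ℝ) ^ 2) / (2 * n r) ≤ m r / r := by
          rw [hnr, div_le_div_iff₀ (by positivity) hr0]
          have : ((k r : ℝ) - 1) * (m r ^ 2 - (⌊m r⌋₊ : ℝ) ^ 2) ≤ k r * (2 * m r) := by
            gcongr
            linarith
          nlinarith
        have he := abs_zkLogError_le (hk r) (hn r) hf1 (by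
          have : 2 * (⌊m r⌋₊ : ℝ) ≤ r := by linarith
          exact_mod_cast this)
        have he1 : (⌊m r⌋₊ : ℝ) ^ 3 / (r : ℝ) ^ 2 ≤ m r ^ 3 / (r : ℝ) ^ 2 := by gcongr
        have he2 : (⌊m r⌋₊ : ℝ) / r ≤ m r / r := by gcongr
        have ha : 0 ≤ m r ^ 3 / (r : ℝ) ^ 2 := by positivity
        have hl0 := abs_nonneg (Real.log (⌊m r⌋₊ / m r))
        refine (abs_add_le _ _).trans ?_
        have := abs_add_le (Real.log (⌊m r⌋₊ / m r))
          (((k r : ℝ) - 1) * (m r ^ 2 - (⌊m r⌋₊ : ℝ) ^ 2) / (2 * n r))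
        rw [abs_of_nonneg hq0] at this
        linarith)
    refine ⟨E₁, E₂, ?_, hE₁, hE₂⟩
    filter_upwards [hE, hm1, hm2] with r h h1 h2
    have hfl : (⌊m r⌋₊ : ℝ) ≤ m r := Nat.floor_le (by linarith)
    have hf1 : 1 ≤ ⌊m r⌋₊ := Nat.one_le_floor_iff (m r) |>.mpr h1
    have hf0 : (0 : ℝ) < ⌊m r⌋₊ := by exact_mod_cast hf1
    have hlt : ⌊m r⌋₊ < r := by
      have : (⌊m r⌋₊ : ℝ) < r := by linarith
      exact_mod_cast this
    have hm0 : 0 < m r := by linarith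
    rw [add_assoc, ← h, zkProb_eq_exp_zkLogError (hk r) (hn r) hf1 hlt,
      show -(((k r : ℝ) - 1) * m r ^ 2 / (2 * n r)) + (zkLogError (n r) (k r) ⌊m r⌋₊ +
        (Real.log (⌊m r⌋₊ / m r) +
          ((k r : ℝ) - 1) * (m r ^ 2 - (⌊m r⌋₊ : ℝ) ^ 2) / (2 * n r))) =
        Real.log (⌊m r⌋₊ / m r) + (-(((k r : ℝ) - 1) * (⌊m r⌋₊ : ℝ) ^ 2 / (2 * n r)) +
          zkLogError (n r) (k r) ⌊m r⌋₊) by ring,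
      Real.exp_add (Real.log _), Real.exp_log (by positivity), ← mul_assoc]
    congr 1
    field_simp
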